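/- For every nonnegative integer m, (1/m!) ∫_{1}^{∞} {x}² (log x)^m / x² dx = 1 − (−1)^m + 2 ∑_{k=0}^{m+1} (−1)^k ζ^{(k)}(0) / k! − ∑_{k=0}^{m} γ_k / k!, where ζ^{(k)}(0) denotes the k-th derivative of the Riemann zeta function at 0. -/

import Mathlib

open Filter Finset MeasureTheory

/-- The Stieltjes constants `γ_n`. -/
noncomputable def stieltjes (n : ℕ) : ℝ :=
  limUnder atTop (fun N : ℕ =>
    (∑ k ∈ Finset.range N, Real.log ((k : ℝ) + 1) ^ n / ((k : ℝ) + 1)) -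
      Real.log (N : ℝ) ^ (n + 1) / ((n : ℝ) + 1))

open scoped Topology

theorem iteratedDeriv_succ_id_mul {F : ℂ → ℂ} (hF : AnalyticAt ℂ F 0) (k : ℕ) :
    iteratedDeriv (k + 1) (fun z => z * F z) 0 = (k + 1) * iteratedDeriv k F 0 := by
  induction k generalizing F with
  | zero =>
    have h := (hasDerivAt_id' (0 : ℂ)).fun_mul hF.differentiableAt.hasDerivAt
    simpa [iteratedDeriv_one] using h.deriv
  | succ k ih =>
    have h1 : deriv (fun z => z * F z) =ᶠ[𝓝 0] fun z => F z + z * deriv F z := by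
      filter_upwards [hF.eventually_analyticAt] with z hz
      have h := (hasDerivAt_id' z).fun_mul hz.differentiableAt.hasDerivAt
      simpa using h.deriv
    have h2 : AnalyticAt ℂ (fun z => z * deriv F z) 0 := analyticAt_id.mul hF.deriv
    rw [iteratedDeriv_succ', h1.iteratedDeriv_eq, iteratedDeriv_fun_add
      (hF.contDiffAt) (h2.contDiffAt), ih hF.deriv, ← iteratedDeriv_succ']
    push_cast
    ring

/-- Taylor coefficients at `0` of a complex function. -/
noncomputable def taylorCoeffZero (F : ℂ → ℂ) (k : ℕ) : ℂ := iteratedDeriv k F 0 / (k.factorial : ℂ)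

theorem taylorCoeffZero_zero (F : ℂ → ℂ) : taylorCoeffZero F 0 = F 0 := by
  simp [taylorCoeffZero]

theorem taylorCoeffZero_id_mul {F : ℂ → ℂ} (hF : AnalyticAt ℂ F 0) (k : ℕ) :
    taylorCoeffZero (fun z => z * F z) (k + 1) = taylorCoeffZero F k := by
  have : (k.factorial : ℂ) ≠ 0 := by exact_mod_cast k.factorial_ne_zero
  have : (k + 1 : ℂ) ≠ 0 := by exact_mod_cast k.succ_ne_zero
  rw [taylorCoeffZero, taylorCoeffZero, iteratedDeriv_succ_id_mul hF, Nat.factorial_succ]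
  push_cast
  field_simp

theorem taylorCoeffZero_add {F G : ℂ → ℂ} (hF : AnalyticAt ℂ F 0) (hG : AnalyticAt ℂ G 0) (k : ℕ) :
    taylorCoeffZero (fun z => F z + G z) k = taylorCoeffZero F k + taylorCoeffZero G k := by
  rw [taylorCoeffZero, iteratedDeriv_fun_add hF.contDiffAt hG.contDiffAt, add_div]; rfl

theorem taylorCoeffZero_sub {F G : ℂ → ℂ} (hF : AnalyticAt ℂ F 0) (hG : AnalyticAt ℂ G 0) (k : ℕ) :
    taylorCoeffZero (fun z => F z - G z) k = taylorCoeffZero F k - taylorCoeffZero G k := by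
  rw [taylorCoeffZero, iteratedDeriv_fun_sub hF.contDiffAt hG.contDiffAt, sub_div]; rfl

theorem taylorCoeffZero_congr {F G : ℂ → ℂ} (h : F =ᶠ[𝓝 0] G) (k : ℕ) :
    taylorCoeffZero F k = taylorCoeffZero G k := by
  rw [taylorCoeffZero, taylorCoeffZero, h.iteratedDeriv_eq]

/-- The Taylor coefficients at `0` of `F / (1 - z)` are the partial sums of those of `F`. -/
theorem taylorCoeffZero_eq_sum {F G : ℂ → ℂ} (hG : AnalyticAt ℂ G 0)
    (h : F =ᶠ[𝓝 0] fun z => G z - z * G z) (k : ℕ) :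
    taylorCoeffZero G k = ∑ j ∈ Finset.range (k + 1), taylorCoeffZero F j := by
  have hz : AnalyticAt ℂ (fun z => z * G z) 0 := analyticAt_id.mul hG
  induction k with
  | zero => simp [taylorCoeffZero_zero, h.self_of_nhds]
  | succ k ih =>
    rw [Finset.sum_range_succ, ← ih, taylorCoeffZero_congr h, taylorCoeffZero_sub hG hz,
      taylorCoeffZero_id_mul hG]
    ring

theorem taylorCoeffZero_one_add_inv (k : ℕ) :
    taylorCoeffZero (fun z => (1 + z)⁻¹) k = (-1) ^ k := by
  have hR : AnalyticAt ℂ (fun z : ℂ => (1 + z)⁻¹) 0 :=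
    (analyticAt_const.add analyticAt_id).inv (by simp)
  induction k with
  | zero => simp [taylorCoeffZero_zero]
  | succ k ih =>
    have h : (fun z : ℂ => (1 + z)⁻¹ + z * (1 + z)⁻¹) =ᶠ[𝓝 0] fun _ => 1 := by
      have : ∀ᶠ z : ℂ in 𝓝 0, 1 + z ≠ 0 :=
        (by fun_prop : Continuous fun z : ℂ => 1 + z).continuousAt.eventually_ne (by simp)
      filter_upwards [this] with z hz
      field_simp
    have h1 := taylorCoeffZero_congr h (k + 1)
    have hz : AnalyticAt ℂ (fun z : ℂ => z * (1 + z)⁻¹) 0 := analyticAt_id.mul hR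
    rw [taylorCoeffZero_add hR hz, taylorCoeffZero_id_mul hR, ih] at h1
    have h2 : taylorCoeffZero (fun _ => 1) (k + 1) = 0 := by
      simp [taylorCoeffZero, iteratedDeriv_const]
    rw [h2] at h1
    rw [pow_succ]
    linear_combination h1

theorem taylorCoeffZero_comp_neg (F : ℂ → ℂ) (k : ℕ) :
    taylorCoeffZero (fun z => F (-z)) k = (-1) ^ k * iteratedDeriv k F 0 / (k.factorial : ℂ) := by
  rw [taylorCoeffZero, iteratedDeriv_comp_neg]; simp

section MellinLog

variable {f : ℝ → ℂ}

theorem mellin_log_pow_smul (hm : Measurable f) (hb : ∀ t, ‖f t‖ ≤ 1) (h0 : ∀ t ≤ 1, f t = 0)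
    (n : ℕ) {w : ℂ} (hw : w.re < 0) :
    MellinConvergent (fun t => Real.log t ^ n • f t) w ∧
      HasDerivAt (mellin (fun t => Real.log t ^ n • f t))
        (mellin (fun t => Real.log t ^ (n + 1) • f t) w) w := by
  have hfc : LocallyIntegrableOn (fun t => Real.log t ^ n • f t) (Set.Ioi 0) := by
    have h1 : LocallyIntegrable f volume :=
      (locallyIntegrable_const (1 : ℝ)).mono hm.aestronglyMeasurable
        (Eventually.of_forall fun t => by simpa using hb t)
    refine (h1.locallyIntegrableOn _).continuousOn_smul isOpen_Ioi.isLocallyClosed ?_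
    exact (Real.continuousOn_log.mono fun x hx => ne_of_gt hx).pow n
  have htop : (fun t => Real.log t ^ n • f t) =O[atTop] fun t : ℝ => t ^ (-(w.re / 2)) := by
    have h1 := isLittleO_log_rpow_rpow_atTop (n : ℝ) (show 0 < -(w.re / 2) by linarith)
    simp only [Real.rpow_natCast] at h1
    refine Asymptotics.IsBigO.trans ?_ h1.isBigO
    refine Asymptotics.IsBigO.of_bound 1 (Eventually.of_forall fun t => ?_)
    rw [norm_smul, one_mul]
    exact mul_le_of_le_one_right (norm_nonneg _) (hb t)
  have hbot : (fun t => Real.log t ^ n • f t) =O[𝓝[>] 0] fun t : ℝ => t ^ (-(w.re - 1)) := by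
    have : (fun t => Real.log t ^ n • f t) =ᶠ[𝓝[>] 0] fun _ => 0 := by
      filter_upwards [nhdsWithin_le_nhds (Iio_mem_nhds (show (0 : ℝ) < 1 by norm_num))] with t ht
      rw [h0 t (le_of_lt ht), smul_zero]
    exact this.trans_isBigO (Asymptotics.isBigO_zero _ _)
  refine ⟨mellinConvergent_of_isBigO_rpow hfc htop (by linarith) hbot (by linarith), ?_⟩
  have h := (mellin_hasDerivAt_of_isBigO_rpow (s := w) hfc htop (by linarith) hbot (by linarith)).2
  simpa only [smul_smul, ← pow_succ'] using h

theorem iteratedDeriv_mellin (hm : Measurable f) (hb : ∀ t, ‖f t‖ ≤ 1) (h0 : ∀ t ≤ 1, f t = 0)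
    (n : ℕ) {w : ℂ} (hw : w.re < 0) :
    iteratedDeriv n (mellin f) w = mellin (fun t => Real.log t ^ n • f t) w := by
  induction n generalizing w with
  | zero => simp
  | succ n ih =>
    have h : iteratedDeriv n (mellin f) =ᶠ[𝓝 w] mellin (fun t => Real.log t ^ n • f t) := by
      filter_upwards [(isOpen_lt Complex.continuous_re continuous_const).mem_nhds hw] with z hz
      exact ih hz
    rw [iteratedDeriv_succ, h.deriv_eq, (mellin_log_pow_smul hm hb h0 n hw).2.deriv]

theorem differentiableAt_mellin (hm : Measurable f) (hb : ∀ t, ‖f t‖ ≤ 1) (h0 : ∀ t ≤ 1, f t = 0)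
    {w : ℂ} (hw : w.re < 0) : DifferentiableAt ℂ (mellin f) w := by
  simpa using (mellin_log_pow_smul hm hb h0 0 hw).2.differentiableAt

end MellinLog

/-- The restriction of a real function to `(1, ∞)`, extended by zero and viewed in `ℂ`. -/
noncomputable def cutoffOne (g : ℝ → ℝ) : ℝ → ℂ :=
  (Set.Ioi (1 : ℝ)).indicator fun t => (g t : ℂ)

section CutoffOne

variable {g : ℝ → ℝ}

theorem measurable_cutoffOne (hg : Measurable g) : Measurable (cutoffOne g) :=
  (Complex.measurable_ofReal.comp hg).indicator measurableSet_Ioi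

theorem norm_cutoffOne_le (hb : ∀ t, |g t| ≤ 1) (t : ℝ) : ‖cutoffOne g t‖ ≤ 1 := by
  refine (norm_indicator_le_norm_self _ _).trans ?_
  simpa using hb t

theorem cutoffOne_of_le {t : ℝ} (ht : t ≤ 1) : cutoffOne g t = 0 :=
  Set.indicator_of_notMem (by simpa using ht) _

theorem cutoffOne_of_lt {t : ℝ} (ht : 1 < t) : cutoffOne g t = g t :=
  Set.indicator_of_mem (by simpa using ht) _

theorem mellin_log_pow_smul_cutoffOne (g : ℝ → ℝ) (n : ℕ) (w : ℂ) :
    mellin (fun t => Real.log t ^ n • cutoffOne g t) w =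
      ∫ t in Set.Ioi (1 : ℝ), (t : ℂ) ^ (w - 1) * (Real.log t ^ n * g t : ℝ) := by
  rw [mellin, setIntegral_eq_of_subset_of_forall_sdiff_eq_zero (s := Set.Ioi 1) measurableSet_Ioi
    (Set.Ioi_subset_Ioi zero_le_one)]
  · refine setIntegral_congr_fun measurableSet_Ioi fun t ht => ?_
    simp [cutoffOne_of_lt ht]
  · intro t ht
    simp [cutoffOne_of_le (not_lt.mp ht.2)]

theorem cpow_mul_log_pow_eq (g : ℝ → ℝ) (n : ℕ) (t : ℝ) :
    (t : ℂ) ^ ((-1 : ℂ) - 1) * (Real.log t ^ n * g t : ℝ) =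
      ((g t * Real.log t ^ n / t ^ 2 : ℝ) : ℂ) := by
  have h : ((-1 : ℂ) - 1) = -((2 : ℕ) : ℂ) := by norm_num
  rw [h, Complex.cpow_neg, Complex.cpow_natCast]
  push_cast
  ring

theorem mellin_log_pow_smul_cutoffOne_neg_one (g : ℝ → ℝ) (n : ℕ) :
    mellin (fun t => Real.log t ^ n • cutoffOne g t) (-1) =
      ((∫ t in Set.Ioi (1 : ℝ), g t * Real.log t ^ n / t ^ 2 : ℝ) : ℂ) := by
  rw [mellin_log_pow_smul_cutoffOne, ← integral_complex_ofReal]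
  exact setIntegral_congr_fun measurableSet_Ioi fun t _ => cpow_mul_log_pow_eq g n t

theorem integrableOn_mul_log_pow_div_sq (hg : Measurable g) (hb : ∀ t, |g t| ≤ 1) (n : ℕ) :
    IntegrableOn (fun t => g t * Real.log t ^ n / t ^ 2) (Set.Ioi 1) := by
  have h := (mellin_log_pow_smul (measurable_cutoffOne hg) (norm_cutoffOne_le hb)
    (fun _ => cutoffOne_of_le) n (w := -1) (by simp)).1
  rw [MellinConvergent] at h
  have h1 := h.mono_set (Set.Ioi_subset_Ioi zero_le_one)
  have h2 : IntegrableOn (fun t => ((g t * Real.log t ^ n / t ^ 2 : ℝ) : ℂ)) (Set.Ioi 1) := by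
    refine h1.congr_fun (fun t ht => ?_) measurableSet_Ioi
    simp only
    rw [← cpow_mul_log_pow_eq g n t, cutoffOne_of_lt ht]
    simp
  exact h2.re

end CutoffOne

theorem continuous_fract_sq_sub_fract : Continuous fun t : ℝ => Int.fract t ^ 2 - Int.fract t :=
  ContinuousOn.comp_fract'' (f := fun u : ℝ => u ^ 2 - u) (by fun_prop) (by norm_num)

theorem abs_fract_sq_sub_fract_le (t : ℝ) : |Int.fract t ^ 2 - Int.fract t| ≤ 1 := by
  have h0 := Int.fract_nonneg t
  have h1 := Int.fract_lt_one t
  rw [abs_le]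
  constructor <;> nlinarith

theorem hasDerivWithinAt_fract (t : ℝ) : HasDerivWithinAt (Int.fract : ℝ → ℝ) 1 (Set.Ioi t) t := by
  have h : HasDerivWithinAt (fun x : ℝ => x - ⌊t⌋) 1 (Set.Ioi t) t :=
    ((hasDerivAt_id' t).sub_const _).hasDerivWithinAt
  refine h.congr_of_eventuallyEq ?_ rfl
  filter_upwards [Ioo_mem_nhdsGT (Int.lt_floor_add_one t)] with x hx
  have : ⌊x⌋ = ⌊t⌋ := by
    rw [Int.floor_eq_iff]
    exact ⟨(Int.floor_le t).trans hx.1.le, hx.2⟩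
  rw [Int.fract, this]

theorem integrableOn_ofReal_mul_cpow {g : ℝ → ℝ} (hg : Measurable g) (hb : ∀ t, |g t| ≤ 1) {a : ℂ}
    (ha : a.re < -1) : IntegrableOn (fun t : ℝ => (g t : ℂ) * (t : ℂ) ^ a) (Set.Ioi 1) := by
  refine (integrableOn_Ioi_cpow_of_lt ha one_pos).bdd_mul (c := 1)
    (Complex.measurable_ofReal.comp hg).aestronglyMeasurable (Eventually.of_forall fun t => ?_)
  simpa using hb t

theorem integrableOn_two_mul_fract_sub_one_mul_cpow {s : ℂ} (hs : 0 < s.re) :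
    IntegrableOn (fun t : ℝ => (2 * ((Int.fract t : ℝ) : ℂ) - 1) * (t : ℂ) ^ (-s - 1))
      (Set.Ioi 1) := by
  have h := integrableOn_ofReal_mul_cpow (g := fun t => 2 * Int.fract t - 1)
    ((measurable_fract.const_mul 2).sub_const 1) (fun t => by
      have h0 := Int.fract_nonneg t
      have h1 := Int.fract_lt_one t
      rw [abs_le]
      constructor <;> linarith) (a := -s - 1) (by simp; linarith)
  simpa using h

theorem integral_fract_by_parts {s : ℂ} (hs : 0 < s.re) :
    ∫ t in Set.Ioi (1 : ℝ), (2 * ((Int.fract t : ℝ) : ℂ) - 1) * (t : ℂ) ^ (-s - 1) =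
      (s + 1) * ∫ t in Set.Ioi (1 : ℝ), ((Int.fract t ^ 2 - Int.fract t : ℝ) : ℂ) *
        (t : ℂ) ^ (-s - 2) := by
  have hI1 := integrableOn_two_mul_fract_sub_one_mul_cpow hs
  have hI2 := integrableOn_ofReal_mul_cpow continuous_fract_sq_sub_fract.measurable
    abs_fract_sq_sub_fract_le (a := -s - 2) (by simp; linarith)
  set φ : ℝ → ℂ := fun t => ((Int.fract t ^ 2 - Int.fract t : ℝ) : ℂ) * (t : ℂ) ^ (-s - 1) with hφ
  set ψ : ℝ → ℂ := fun t => (2 * ((Int.fract t : ℝ) : ℂ) - 1) * (t : ℂ) ^ (-s - 1) -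
    (s + 1) * (((Int.fract t ^ 2 - Int.fract t : ℝ) : ℂ) * (t : ℂ) ^ (-s - 2)) with hψ
  have hIψ : IntegrableOn ψ (Set.Ioi 1) := hI1.sub (hI2.const_mul _)
  have hd : ∀ t : ℝ, 1 ≤ t → HasDerivAt (fun x : ℝ => (x : ℂ) ^ (-s - 1))
      ((-s - 1) * (t : ℂ) ^ (-s - 2)) t := by
    intro t ht
    have hne : (-s - 1) ≠ 0 := by
      intro h
      have := congrArg Complex.re h
      simp at this
      linarith
    have h := hasDerivAt_ofReal_cpow_const' (x := t) (by positivity) (r := -s - 2) (by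
      intro h
      apply hne
      linear_combination h)
    have h2 := h.const_mul (-s - 1)
    have e : -s - 2 + 1 = -s - 1 := by ring
    rw [e] at h2
    refine h2.congr_of_eventuallyEq (Eventually.of_forall fun x => ?_)
    field_simp
  have hint : ∀ N : ℝ, 1 ≤ N → ∫ t in (1 : ℝ)..N, ψ t = φ N := by
    intro N hN
    have h := intervalIntegral.integral_eq_sub_of_hasDeriv_right_of_le (f := φ) (f' := ψ) hN ?_ ?_ ?_
    · rw [h]; simp [hφ]
    · refine (Complex.continuous_ofReal.comp continuous_fract_sq_sub_fract).continuousOn.mul ?_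
      exact fun t ht => (hd t ht.1).continuousAt.continuousWithinAt
    · intro t ht
      have h1 := ((hasDerivWithinAt_fract t).pow 2).sub (hasDerivWithinAt_fract t)
      have h2 := h1.ofReal_comp.mul (hd t ht.1.le).hasDerivWithinAt
      refine h2.congr_deriv ?_
      simp [hψ]
      ring
    · rw [intervalIntegrable_iff_integrableOn_Ioc_of_le hN]
      exact hIψ.mono_set Set.Ioc_subset_Ioi_self
  have hlim : Tendsto φ atTop (𝓝 0) := by
    have h1 : Tendsto (fun t : ℝ => t ^ (-(s.re + 1))) atTop (𝓝 0) :=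
      tendsto_rpow_neg_atTop (by linarith)
    refine squeeze_zero_norm' ?_ h1
    filter_upwards [eventually_gt_atTop 0] with t ht
    rw [hφ, norm_mul, Complex.norm_cpow_eq_rpow_re_of_pos ht]
    have e : (-s - 1).re = -(s.re + 1) := by simp; ring
    rw [e]
    refine mul_le_of_le_one_left (by positivity) ?_
    rw [Complex.norm_real]
    exact abs_fract_sq_sub_fract_le t
  have hzero : ∫ t in Set.Ioi (1 : ℝ), ψ t = 0 := by
    refine tendsto_nhds_unique (intervalIntegral_tendsto_integral_Ioi 1 hIψ tendsto_id) ?_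
    refine hlim.congr' ?_
    filter_upwards [eventually_ge_atTop 1] with N hN
    exact (hint N hN).symm
  rw [hψ, integral_sub hI1 (hI2.const_mul _), integral_const_mul, sub_eq_zero] at hzero
  exact hzero

theorem riemannZeta_eq_integral {s : ℂ} (hs : 1 < s.re) :
    riemannZeta s = s / (s - 1) - 1 / 2 - s * (s + 1) / 2 *
      ∫ t in Set.Ioi (1 : ℝ), ((Int.fract t ^ 2 - Int.fract t : ℝ) : ℂ) * (t : ℂ) ^ (-s - 2) := by
  have hs0 : s ≠ 0 := by
    rintro rfl
    norm_num at hs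
  have hs1 : s - 1 ≠ 0 := by
    intro h
    rw [sub_eq_zero.mp h] at hs
    norm_num at hs
  have hL := LSeries_eq_mul_integral_of_nonneg (fun _ => 1) zero_le_one hs (by
    simpa using Asymptotics.isBigO_refl (fun n : ℕ => (n : ℝ)) atTop) (fun _ => zero_le_one)
  have hζ : LSeries (fun _ => ((1 : ℝ) : ℂ)) s = riemannZeta s := by
    rw [← LSeries_one_eq_riemannZeta hs]
    congr 1
  have hA : IntegrableOn (fun t : ℝ => (t : ℂ) ^ (-s)) (Set.Ioi 1) :=
    integrableOn_Ioi_cpow_of_lt (by simpa using hs) one_pos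
  have hB : IntegrableOn (fun t : ℝ => (t : ℂ) ^ (-s - 1)) (Set.Ioi 1) :=
    integrableOn_Ioi_cpow_of_lt (by simp; linarith) one_pos
  have hI1 := integrableOn_two_mul_fract_sub_one_mul_cpow (zero_lt_one.trans hs)
  have hsplit : ∫ t in Set.Ioi (1 : ℝ), (∑ k ∈ Finset.Icc 1 ⌊t⌋₊, ((1 : ℝ) : ℂ)) *
      (t : ℂ) ^ (-(s + 1)) = (∫ t in Set.Ioi (1 : ℝ), (t : ℂ) ^ (-s)) -
        ((1 / 2) * (∫ t in Set.Ioi (1 : ℝ), (t : ℂ) ^ (-s - 1)) +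
        (1 / 2) * ∫ t in Set.Ioi (1 : ℝ), (2 * ((Int.fract t : ℝ) : ℂ) - 1) * (t : ℂ) ^ (-s - 1)) := by
    rw [← integral_const_mul, ← integral_const_mul,
      ← integral_add (hB.const_mul _) (hI1.const_mul _), ← integral_sub hA
        (show Integrable (fun t : ℝ => 1 / 2 * (t : ℂ) ^ (-s - 1) + 1 / 2 *
          ((2 * ((Int.fract t : ℝ) : ℂ) - 1) * (t : ℂ) ^ (-s - 1))) _ from
          (hB.const_mul _).add (hI1.const_mul _))]
    refine setIntegral_congr_fun measurableSet_Ioi fun t (ht : 1 < t) => ?_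
    have ht0 : (t : ℂ) ≠ 0 := by exact_mod_cast (zero_lt_one.trans ht).ne'
    have e1 : (t : ℂ) ^ (-s) = t * (t : ℂ) ^ (-s - 1) := by
      rw [Complex.cpow_sub _ _ ht0, Complex.cpow_one]
      field_simp
    have e2 : ((⌊t⌋₊ : ℕ) : ℂ) = t - ((Int.fract t : ℝ) : ℂ) := by
      have h : ((⌊t⌋₊ : ℕ) : ℝ) = t - Int.fract t := by
        rw [natCast_floor_eq_intCast_floor (by linarith), Int.self_sub_fract]
      rw [← Complex.ofReal_sub, ← h, Complex.ofReal_natCast]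
    have e3 : -(s + 1) = -s - 1 := by ring
    simp only [e1, e3]
    rw [Complex.ofReal_one, Finset.sum_const, Nat.card_Icc, Nat.add_sub_cancel, nsmul_one, e2]
    ring
  have hne : -s + 1 ≠ 0 := fun h => hs1 (by linear_combination -h)
  rw [← hζ, hL, hsplit, integral_fract_by_parts (by linarith),
    integral_Ioi_cpow_of_lt (by simpa using hs) one_pos,
    integral_Ioi_cpow_of_lt (by simp; linarith) one_pos]
  simp only [Complex.ofReal_one, Complex.one_cpow]
  have e4 : -s - 1 + 1 = -s := by ring
  rw [e4]
  field_simp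
  ring

/-- The integral of `{t} (log t) ^ n / t ^ 2` over `(1, ∞)`. -/
noncomputable def fractLogIntegral (n : ℕ) : ℝ :=
  ∫ t in Set.Ioi (1 : ℝ), Int.fract t * Real.log t ^ n / t ^ 2

theorem abs_fract_le_one (t : ℝ) : |Int.fract t| ≤ 1 := by
  rw [abs_of_nonneg (Int.fract_nonneg t)]
  exact (Int.fract_lt_one t).le

theorem hasDerivAt_log_pow_div (n : ℕ) (c : ℝ) {t : ℝ} (ht : 0 < t) :
    HasDerivAt (fun x => (x - c) * (Real.log x ^ n / x) - Real.log x ^ (n + 1) / ((n : ℝ) + 1))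
      (n * ((t - c) * Real.log t ^ (n - 1) / t ^ 2) - (t - c) * Real.log t ^ n / t ^ 2) t := by
  have hl := Real.hasDerivAt_log ht.ne'
  have h1 := ((hasDerivAt_id' t).sub_const c).fun_mul
    ((hl.fun_pow n).fun_div (hasDerivAt_id' t) ht.ne')
  have h2 := (hl.fun_pow (n + 1)).div_const ((n : ℝ) + 1)
  refine (h1.fun_sub h2).congr_deriv ?_
  have : (n : ℝ) + 1 ≠ 0 := by positivity
  push_cast
  field_simp
  ring

theorem sum_log_pow_div_sub_eq_integral (n N : ℕ) :
    (∑ k ∈ Finset.range (N + 1), Real.log ((k : ℝ) + 1) ^ n / ((k : ℝ) + 1)) -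
      Real.log ((N + 1 : ℕ) : ℝ) ^ (n + 1) / ((n : ℝ) + 1) =
    (if n = 0 then 1 else 0) + ∫ t in (1 : ℝ)..((N + 1 : ℕ) : ℝ),
      (n * (Int.fract t * Real.log t ^ (n - 1) / t ^ 2) - Int.fract t * Real.log t ^ n / t ^ 2) := by
  have hI : IntegrableOn (fun t : ℝ => n * (Int.fract t * Real.log t ^ (n - 1) / t ^ 2) -
      Int.fract t * Real.log t ^ n / t ^ 2) (Set.Ioi 1) :=
    ((integrableOn_mul_log_pow_div_sq measurable_fract abs_fract_le_one (n - 1)).const_mul _).sub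
      (integrableOn_mul_log_pow_div_sq measurable_fract abs_fract_le_one n)
  have hII : ∀ a b : ℝ, 1 ≤ a → a ≤ b → IntervalIntegrable (fun t : ℝ =>
      n * (Int.fract t * Real.log t ^ (n - 1) / t ^ 2) -
      Int.fract t * Real.log t ^ n / t ^ 2) volume a b := by
    intro a b ha hab
    rw [intervalIntegrable_iff_integrableOn_Ioc_of_le hab]
    exact hI.mono_set (Set.Ioc_subset_Ioi_self.trans (Set.Ioi_subset_Ioi ha))
  induction N with
  | zero => simp [zero_pow_eq]
  | succ N ih =>
    have hN : (1 : ℝ) ≤ ((N + 1 : ℕ) : ℝ) := by norm_cast; omega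
    have hN' : ((N + 1 : ℕ) : ℝ) ≤ ((N + 1 + 1 : ℕ) : ℝ) := by norm_cast; omega
    have hstep := intervalIntegral.integral_eq_sub_of_hasDerivAt_of_le hN'
      (f := fun x => (x - ((N + 1 : ℕ) : ℝ)) * (Real.log x ^ n / x) -
        Real.log x ^ (n + 1) / ((n : ℝ) + 1))
      (f' := fun t : ℝ => n * (Int.fract t * Real.log t ^ (n - 1) / t ^ 2) -
        Int.fract t * Real.log t ^ n / t ^ 2)
      (fun t ht => (hasDerivAt_log_pow_div n _
        (by linarith [ht.1])).continuousAt.continuousWithinAt)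
      (fun t ht => by
        have hf : Int.fract t = t - ((N + 1 : ℕ) : ℝ) := by
          have : ⌊t⌋ = ((N + 1 : ℕ) : ℤ) := by
            rw [Int.floor_eq_iff]
            refine ⟨by exact_mod_cast ht.1.le, ?_⟩
            have := ht.2
            push_cast at this ⊢
            exact this
          rw [Int.fract, this, Int.cast_natCast]
        rw [hf]
        exact hasDerivAt_log_pow_div n _ (by linarith [ht.1]))
      (hII _ _ hN hN')
    rw [Finset.sum_range_succ, ← intervalIntegral.integral_add_adjacent_intervals
      (hII _ _ le_rfl hN) (hII _ _ hN hN'), ← add_assoc, ← ih, hstep]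
    push_cast
    ring

theorem stieltjes_eq (n : ℕ) :
    stieltjes n = (if n = 0 then 1 else 0) + (n * fractLogIntegral (n - 1) - fractLogIntegral n) := by
  have h1 := (integrableOn_mul_log_pow_div_sq measurable_fract abs_fract_le_one (n - 1)).const_mul
    (n : ℝ)
  have h2 := integrableOn_mul_log_pow_div_sq measurable_fract abs_fract_le_one n
  have hb : Tendsto (fun N : ℕ => ((N + 1 : ℕ) : ℝ)) atTop atTop :=
    tendsto_natCast_atTop_atTop.comp (tendsto_add_atTop_nat 1)
  have h3 := intervalIntegral_tendsto_integral_Ioi (1 : ℝ) (Integrable.sub h1 h2) hb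
  refine Tendsto.limUnder_eq ?_
  rw [← tendsto_add_atTop_iff_nat 1]
  simp only [sum_log_pow_div_sub_eq_integral]
  refine Tendsto.const_add _ ?_
  rw [fractLogIntegral, fractLogIntegral, ← integral_const_mul, ← integral_sub h1 h2]
  exact h3

theorem sum_stieltjes_div_factorial (m : ℕ) :
    ∑ k ∈ Finset.range (m + 1), stieltjes k / (k.factorial : ℝ) =
      1 - fractLogIntegral m / (m.factorial : ℝ) := by
  induction m with
  | zero => simp [stieltjes_eq]; ring
  | succ m ih =>
    have : (m.factorial : ℝ) ≠ 0 := by exact_mod_cast m.factorial_ne_zero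
    have : (m + 1 : ℝ) ≠ 0 := by positivity
    rw [Finset.sum_range_succ, ih, stieltjes_eq, if_neg (Nat.add_one_ne_zero m), Nat.add_sub_cancel,
      Nat.factorial_succ]
    push_cast
    field_simp
    ring

/-- The integral of `({t} ^ 2 - {t}) t ^ (z - 2)` over `(1, ∞)`, as a function of `z`. -/
noncomputable def fractMellin (z : ℂ) : ℂ :=
  mellin (cutoffOne fun t => Int.fract t ^ 2 - Int.fract t) (z - 1)

theorem fractMellin_eq_integral (z : ℂ) :
    fractMellin z = ∫ t in Set.Ioi (1 : ℝ), ((Int.fract t ^ 2 - Int.fract t : ℝ) : ℂ) *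
      (t : ℂ) ^ (z - 2) := by
  have h := mellin_log_pow_smul_cutoffOne (fun t => Int.fract t ^ 2 - Int.fract t) 0 (z - 1)
  simp only [pow_zero, one_smul, one_mul] at h
  rw [fractMellin, h]
  refine setIntegral_congr_fun measurableSet_Ioi fun t _ => ?_
  have e : z - 1 - 1 = z - 2 := by ring
  simp only [e]
  ring

theorem differentiableOn_fractMellin : DifferentiableOn ℂ fractMellin {z | z.re < 1} := by
  intro z hz
  have h := differentiableAt_mellin (measurable_cutoffOne continuous_fract_sq_sub_fract.measurable)
    (norm_cutoffOne_le abs_fract_sq_sub_fract_le) (fun _ => cutoffOne_of_le) (w := z - 1)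
    (by simpa using hz)
  exact (h.comp z (differentiableAt_id.sub_const 1)).differentiableWithinAt

theorem isOpen_re_lt_one : IsOpen {z : ℂ | z.re < 1} :=
  isOpen_lt Complex.continuous_re continuous_const

theorem taylorCoeffZero_fractMellin (m : ℕ) :
    taylorCoeffZero fractMellin m =
      (((∫ t in Set.Ioi (1 : ℝ), (Int.fract t ^ 2 - Int.fract t) * Real.log t ^ m / t ^ 2) /
        (m.factorial : ℝ) : ℝ) : ℂ) := by
  have h : iteratedDeriv m fractMellin 0 =
      iteratedDeriv m (mellin (cutoffOne fun t => Int.fract t ^ 2 - Int.fract t)) (0 - 1) := by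
    exact congrFun (iteratedDeriv_comp_sub_const m _ 1) 0
  rw [taylorCoeffZero, h, zero_sub, iteratedDeriv_mellin
    (measurable_cutoffOne continuous_fract_sq_sub_fract.measurable)
    (norm_cutoffOne_le abs_fract_sq_sub_fract_le) (fun _ => cutoffOne_of_le) m (by simp),
    mellin_log_pow_smul_cutoffOne_neg_one]
  push_cast
  rfl

theorem riemannZeta₁_neg_eq {z : ℂ} (hz : z.re < 1) :
    riemannZeta₁ (-z) = (1 - z) / 2 * (1 - z * (1 + z) * fractMellin z) := by
  have hA : AnalyticOnNhd ℂ (fun z => riemannZeta₁ (-z)) {z | z.re < 1} :=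
    ((differentiable_riemannZeta₁.comp differentiable_neg).differentiableOn).analyticOnNhd
      isOpen_re_lt_one
  have hB : AnalyticOnNhd ℂ (fun z => (1 - z) / 2 * (1 - z * (1 + z) * fractMellin z))
      {z | z.re < 1} := by
    refine DifferentiableOn.analyticOnNhd ?_ isOpen_re_lt_one
    have := differentiableOn_fractMellin
    fun_prop
  refine hA.eqOn_of_preconnected_of_eventuallyEq hB (convex_halfSpace_re_lt 1).isPreconnected
    (z₀ := -2) (by simp; norm_num) ?_ hz
  filter_upwards [(isOpen_lt Complex.continuous_re continuous_const).mem_nhds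
    (show (-2 : ℂ).re < -1 by simp)] with z (hz : z.re < -1)
  have hs : 1 < (-z).re := by simp; linarith
  have hs1 : -z - 1 ≠ 0 := by
    intro h
    rw [sub_eq_zero.mp h] at hs
    norm_num at hs
  have hne : -z ≠ 1 := fun h => hs1 (by rw [h, sub_self])
  have h1 := riemannZeta_eq_integral hs
  rw [neg_neg, ← fractMellin_eq_integral, riemannZeta_eq_inv_sub_mul hne] at h1
  field_simp at h1 ⊢
  linear_combination h1

theorem taylorCoeffZero_fractMellin_eq_sum (m : ℕ) :
    taylorCoeffZero fractMellin m = -(-1 : ℂ) ^ m + 2 * ∑ k ∈ Finset.range (m + 2),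
      (-1 : ℂ) ^ k * iteratedDeriv k riemannZeta 0 / (k.factorial : ℂ) := by
  have hP : AnalyticAt ℂ fractMellin 0 :=
    differentiableOn_fractMellin.analyticAt (isOpen_re_lt_one.mem_nhds (by simp))
  have hzP : AnalyticAt ℂ (fun z => z * fractMellin z) 0 := analyticAt_id.mul hP
  have hR : AnalyticAt ℂ (fun z : ℂ => (1 + z)⁻¹) 0 :=
    (analyticAt_const.add analyticAt_id).inv (by simp)
  have h : (fun z => 2 * riemannZeta (-z)) =ᶠ[𝓝 0] fun z =>
      (z * fractMellin z - (1 + z)⁻¹) - z * (z * fractMellin z - (1 + z)⁻¹) := by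
    have hne : ∀ᶠ z : ℂ in 𝓝 0, 1 + z ≠ 0 :=
      (by fun_prop : Continuous fun z : ℂ => 1 + z).continuousAt.eventually_ne (by simp)
    filter_upwards [hne, isOpen_re_lt_one.mem_nhds (show (0 : ℂ) ∈ {z : ℂ | z.re < 1} by simp)]
      with z h1 h2
    have h3 : -z ≠ 1 := fun h => h1 (by rw [← h]; ring)
    have h4 : -z - 1 ≠ 0 := sub_ne_zero.mpr h3
    rw [riemannZeta_eq_inv_sub_mul h3, riemannZeta₁_neg_eq h2]
    have h5 : (-z - 1)⁻¹ = -(1 + z)⁻¹ := by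
      rw [← inv_neg]
      congr 1
      ring
    rw [h5]
    field_simp
    ring
  have h6 := taylorCoeffZero_eq_sum (hzP.sub hR) h (m + 1)
  have h7 : ∀ k, taylorCoeffZero (fun z => 2 * riemannZeta (-z)) k =
      2 * ((-1 : ℂ) ^ k * iteratedDeriv k riemannZeta 0 / (k.factorial : ℂ)) := by
    intro k
    rw [← taylorCoeffZero_comp_neg, taylorCoeffZero, taylorCoeffZero,
      iteratedDeriv_const_mul_field, mul_div_assoc]
  have h8 : taylorCoeffZero (fun z => z * fractMellin z - (1 + z)⁻¹) (m + 1) =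
      taylorCoeffZero fractMellin m + (-1) ^ m := by
    rw [taylorCoeffZero_sub hzP hR, taylorCoeffZero_id_mul hP, taylorCoeffZero_one_add_inv, pow_succ]
    ring
  simp only [h7] at h6
  rw [← Finset.mul_sum] at h6
  linear_combination h6 - h8

theorem statement7 (m : ℕ) :
    (((1 / (Nat.factorial m : ℝ)) *
        ∫ x in Set.Ioi (1 : ℝ), Int.fract x ^ 2 * Real.log x ^ m / x ^ 2 : ℝ) : ℂ) =
      1 - (-1 : ℂ) ^ m +
        2 * ∑ k ∈ Finset.range (m + 2),
          (-1 : ℂ) ^ k * iteratedDeriv k riemannZeta 0 / (Nat.factorial k : ℂ) -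
        ((∑ k ∈ Finset.range (m + 1), stieltjes k / (Nat.factorial k : ℝ) : ℝ) : ℂ) := by
  have h1 := integrableOn_mul_log_pow_div_sq (g := fun t => Int.fract t ^ 2 - Int.fract t)
    continuous_fract_sq_sub_fract.measurable abs_fract_sq_sub_fract_le m
  have h2 := integrableOn_mul_log_pow_div_sq measurable_fract abs_fract_le_one m
  have hsum : ∫ x in Set.Ioi (1 : ℝ), Int.fract x ^ 2 * Real.log x ^ m / x ^ 2 =
      (∫ x in Set.Ioi (1 : ℝ), (Int.fract x ^ 2 - Int.fract x) * Real.log x ^ m / x ^ 2) +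
        fractLogIntegral m := by
    rw [fractLogIntegral, ← integral_add h1 h2]
    refine setIntegral_congr_fun measurableSet_Ioi fun t _ => ?_
    ring
  have h3 := taylorCoeffZero_fractMellin m
  rw [taylorCoeffZero_fractMellin_eq_sum] at h3
  rw [hsum, sum_stieltjes_div_factorial]
  push_cast at h3 ⊢
  linear_combination -h3
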